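/- arXiv:2008.01036 — 2 statements merged into one kernel-verified Lean document; each statement's English description precedes it below -/
import Mathlib

section
/- Let P ∈ ℝ^{n×n} be an orthogonal projection matrix (symmetric idempotent), let b ∈ ℝ^n with b ≠ 0 and z := bᵀ(I−P)b/‖b‖² > 0, and let Q = bbᵀ/‖b‖². Then for every v ∈ ℝ^n, ‖(I − Q)(I + PQ/z) v‖² ≤ (1/z)‖v‖². Equivalently, the symmetric matrix M := Q − (PQ + QP)/z + (2/z − 1/z²) QPQ + QPQPQ/z² has rank at most 2, and v ↦ ‖(I−Q)(I+PQ/z)v‖² − ‖v‖² equals −vᵀMv with every eigenvalue of M at least 1 − 1/z. -/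
open Matrix

noncomputable section

/-- Squared Euclidean norm of a vector in `ℝ^n`. -/
def sqnorm {n : ℕ} (v : Fin n → ℝ) : ℝ := ∑ i, v i ^ 2

lemma sqnorm_eq_dotProduct {n : ℕ} (v : Fin n → ℝ) : sqnorm v = v ⬝ᵥ v := by
  simp [sqnorm, dotProduct, sq]

lemma sqnorm_nonneg {n : ℕ} (v : Fin n → ℝ) : 0 ≤ sqnorm v :=
  Finset.sum_nonneg fun _ _ => sq_nonneg _

lemma sqnorm_pos {n : ℕ} {v : Fin n → ℝ} (hv : v ≠ 0) : 0 < sqnorm v := by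
  refine (sqnorm_nonneg v).lt_of_ne fun h => hv ?_
  rw [sqnorm_eq_dotProduct] at h
  exact dotProduct_self_eq_zero.mp h.symm

/-- Cauchy-Schwarz for the dot product. -/
lemma dotProduct_sq_le_sqnorm_mul_sqnorm {n : ℕ} (v w : Fin n → ℝ) :
    (v ⬝ᵥ w) ^ 2 ≤ sqnorm v * sqnorm w :=
  Finset.sum_mul_sq_le_sq_mul_sq _ _ _

lemma matrix_rank_add_le {n : ℕ} (A B : Matrix (Fin n) (Fin n) ℝ) :
    (A + B).rank ≤ A.rank + B.rank := by
  unfold Matrix.rank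
  rw [mulVecLin_add]
  exact (Submodule.finrank_mono (LinearMap.range_add_le _ _)).trans
    (Submodule.finrank_add_le_finrank_add_finrank _ _)

/-- the key quadratic-form estimate in the underparametrized regime. -/
theorem stmt4 (n : ℕ) (P : Matrix (Fin n) (Fin n) ℝ)
    (hPsymm : Pᵀ = P) (hPidem : P * P = P)
    (b : Fin n → ℝ) (hb : b ≠ 0)
    (z : ℝ) (hz : z = (b ⬝ᵥ ((1 - P) *ᵥ b)) / sqnorm b) (hzpos : 0 < z)
    (Q : Matrix (Fin n) (Fin n) ℝ) (hQ : Q = (sqnorm b)⁻¹ • vecMulVec b b)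
    (M : Matrix (Fin n) (Fin n) ℝ)
    (hM : M = Q - z⁻¹ • (P * Q + Q * P) + (2 / z - 1 / z ^ 2) • (Q * P * Q)
        + (z ^ 2)⁻¹ • (Q * P * Q * P * Q)) :
    (∀ v : Fin n → ℝ,
      sqnorm (((1 - Q) * (1 + z⁻¹ • (P * Q))) *ᵥ v) ≤ z⁻¹ * sqnorm v) ∧
    M.rank ≤ 2 ∧
    (∀ v : Fin n → ℝ,
      sqnorm (((1 - Q) * (1 + z⁻¹ • (P * Q))) *ᵥ v) - sqnorm v = -(v ⬝ᵥ (M *ᵥ v))) ∧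
    (∀ t : ℝ, (∃ v : Fin n → ℝ, v ≠ 0 ∧ M *ᵥ v = t • v) → 1 - 1 / z ≤ t) := by
  set s := sqnorm b with hs
  set c := P *ᵥ b with hc
  have hs0 : 0 < s := sqnorm_pos hb
  have hbb : b ⬝ᵥ b = s := (sqnorm_eq_dotProduct b).symm
  have hbP (w : Fin n → ℝ) : w ᵥ* P = P *ᵥ w := by
    conv_lhs => rw [← hPsymm, vecMul_transpose]
  have hbc : b ⬝ᵥ c = (1 - z) * s := by
    rw [sub_mulVec, one_mulVec, dotProduct_sub, hbb, eq_div_iff hs0.ne'] at hz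
    linarith
  have hcb : c ⬝ᵥ b = (1 - z) * s := by rw [dotProduct_comm, hbc]
  have hcc : c ⬝ᵥ c = (1 - z) * s := by
    rw [← hbc, hc, dotProduct_mulVec, hbP, mulVec_mulVec, hPidem, dotProduct_comm]
  have hPQ : P * Q = s⁻¹ • vecMulVec c b := by
    rw [hQ, Matrix.mul_smul, mul_vecMulVec]
  have hQP : Q * P = s⁻¹ • vecMulVec b c := by
    rw [hQ, Matrix.smul_mul, vecMulVec_mul, hbP]
  have hQPQ : Q * P * Q = (1 - z) • Q := by
    rw [hQP, hQ, Matrix.smul_mul, Matrix.mul_smul, vecMulVec_mul_vecMulVec, hcb]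
    ext i j
    simp only [Matrix.smul_apply, vecMulVec_apply, smul_eq_mul, Pi.smul_apply]
    field_simp
  have hM' : M = vecMulVec ((z * s)⁻¹ • (b - c)) b + vecMulVec (-(z * s)⁻¹ • b) c := by
    rw [hM, hQPQ, Matrix.smul_mul, Matrix.smul_mul, hQPQ, hPQ, hQP, hQ]
    ext i j
    simp only [Matrix.smul_apply, vecMulVec_apply, smul_eq_mul, Pi.smul_apply, Matrix.add_apply,
      Matrix.sub_apply,
      Pi.sub_apply]
    field_simp
    ring
  have hMv (v : Fin n → ℝ) :
      v ⬝ᵥ (M *ᵥ v) = (z * s)⁻¹ * ((b ⬝ᵥ v) ^ 2 - 2 * (b ⬝ᵥ v) * (c ⬝ᵥ v)) := by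
    rw [hM', add_mulVec, vecMulVec_mulVec, vecMulVec_mulVec]
    simp only [dotProduct_comm v, add_dotProduct, smul_dotProduct, sub_dotProduct, op_smul_eq_smul,
      smul_eq_mul]
    ring
  have hAv (v : Fin n → ℝ) : ((1 - Q) * (1 + z⁻¹ • (P * Q))) *ᵥ v
      = v + ((b ⬝ᵥ v) / (z * s)) • (c - b) := by
    rw [Matrix.sub_mul, Matrix.one_mul, Matrix.mul_add, Matrix.mul_one, Matrix.mul_smul,
      ← Matrix.mul_assoc, hQPQ, hPQ, hQ]
    simp only [sub_mulVec, add_mulVec, smul_mulVec, one_mulVec, vecMulVec_mulVec,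
      op_smul_eq_smul]
    ext i
    simp only [Pi.smul_apply, Pi.add_apply, Pi.sub_apply, smul_eq_mul]
    field_simp
    ring
  have hform (v : Fin n → ℝ) :
      sqnorm (((1 - Q) * (1 + z⁻¹ • (P * Q))) *ᵥ v) - sqnorm v = -(v ⬝ᵥ (M *ᵥ v)) := by
    rw [hAv, hMv, sqnorm_eq_dotProduct, sqnorm_eq_dotProduct]
    simp only [dotProduct_add, add_dotProduct, dotProduct_smul, smul_dotProduct, dotProduct_sub,
      sub_dotProduct, smul_eq_mul, hbb, hbc, hcb, hcc, dotProduct_comm v b, dotProduct_comm v c]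
    field_simp
    ring
  have hlower (v : Fin n → ℝ) : (1 - 1 / z) * sqnorm v ≤ v ⬝ᵥ (M *ᵥ v) := by
    have hcs := dotProduct_sq_le_sqnorm_mul_sqnorm c v
    rw [sqnorm_eq_dotProduct c, hcc] at hcs
    have h : (1 - 1 / z) * sqnorm v = (z * s)⁻¹ * -((1 - z) * s * sqnorm v) := by
      field_simp
      ring
    rw [hMv, h]
    refine mul_le_mul_of_nonneg_left ?_ (by positivity)
    nlinarith [sq_nonneg (b ⬝ᵥ v - c ⬝ᵥ v)]
  refine ⟨fun v => ?_, ?_, hform, ?_⟩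
  · have h := hlower v
    rw [one_div] at h
    linarith [hform v]
  · rw [hM']
    exact (matrix_rank_add_le _ _).trans (add_le_add (rank_vecMulVec_le _ _) (rank_vecMulVec_le _ _))
  · rintro t ⟨v, hv, hev⟩
    have h := hlower v
    rw [hev, dotProduct_smul, smul_eq_mul, ← sqnorm_eq_dotProduct] at h
    exact le_of_mul_le_mul_right h (sqnorm_pos hv)

end
end

section
/- Let A ∈ ℝ^{n×d} and b ∈ ℝ^n with n ≤ d. Assume that A and the columnwise partitioned matrix [A, b] ∈ ℝ^{n×(d+1)} have linearly independent rows. Let G = (AAᵀ)⁻¹ ∈ ℝ^{n×n} and u = bᵀG/(1 + bᵀGb) ∈ ℝ^{1×n}. Then the Moore–Penrose pseudoinverse of the (d+1)×n matrix [Aᵀ; bᵀ] (Aᵀ with bᵀ appended as a last row) equals the n×(d+1) block matrix [ (I − bu)ᵀ(A⁺)ᵀ , uᵀ ], whose first d columns are (I − bu)ᵀ(A⁺)ᵀ and whose last column is uᵀ. -/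
open Matrix

noncomputable section

/-- Moore–Penrose pseudoinverse of a matrix with linearly independent rows:
`M⁺ = Mᵀ (M Mᵀ)⁻¹`. -/
def pinvRows {m n : ℕ} (M : Matrix (Fin m) (Fin n) ℝ) : Matrix (Fin n) (Fin m) ℝ :=
  Mᵀ * (M * Mᵀ)⁻¹

/-- Moore–Penrose pseudoinverse of a matrix with linearly independent columns:
`M⁺ = (Mᵀ M)⁻¹ Mᵀ`. -/
def pinvCols {m n : ℕ} (M : Matrix (Fin m) (Fin n) ℝ) : Matrix (Fin n) (Fin m) ℝ :=
  (Mᵀ * M)⁻¹ * Mᵀ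

/-- Append a row at the bottom of a matrix. -/
def appendRow {m n : ℕ} (M : Matrix (Fin m) (Fin n) ℝ) (r : Fin n → ℝ) :
    Matrix (Fin (m + 1)) (Fin n) ℝ := Matrix.of (Fin.snoc (fun i => M i) r)

/-- Append a column at the right of a matrix. -/
def appendCol {m n : ℕ} (M : Matrix (Fin m) (Fin n) ℝ) (c : Fin m → ℝ) :
    Matrix (Fin m) (Fin (n + 1)) ℝ := Matrix.of (fun i => Fin.snoc (M i) (c i))

@[simp]
lemma appendCol_castSucc {m n : ℕ} (M : Matrix (Fin m) (Fin n) ℝ) (c : Fin m → ℝ)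
    (i : Fin m) (j : Fin n) : appendCol M c i j.castSucc = M i j := by
  simp [appendCol]

@[simp]
lemma appendCol_last {m n : ℕ} (M : Matrix (Fin m) (Fin n) ℝ) (c : Fin m → ℝ)
    (i : Fin m) : appendCol M c i (Fin.last n) = c i := by
  simp [appendCol]

lemma appendRow_transpose {m n : ℕ} (M : Matrix (Fin m) (Fin n) ℝ) (c : Fin m → ℝ) :
    appendRow Mᵀ c = (appendCol M c)ᵀ := by
  ext i j
  refine Fin.lastCases ?_ (fun i => ?_) i <;> simp [appendRow]

lemma mul_appendCol {l m n : ℕ} (P : Matrix (Fin l) (Fin m) ℝ)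
    (M : Matrix (Fin m) (Fin n) ℝ) (c : Fin m → ℝ) :
    P * appendCol M c = appendCol (P * M) (P *ᵥ c) := by
  ext i j
  refine Fin.lastCases ?_ (fun j => ?_) j <;> simp [Matrix.mul_apply, mulVec, dotProduct]

lemma appendCol_mul_transpose_self {m n : ℕ} (M : Matrix (Fin m) (Fin n) ℝ)
    (c : Fin m → ℝ) :
    appendCol M c * (appendCol M c)ᵀ = M * Mᵀ + vecMulVec c c := by
  ext i j
  simp [Matrix.mul_apply, Fin.sum_univ_castSucc, vecMulVec_apply]

/-- The Gram matrix of linearly independent rows is positive definite. -/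
lemma posDef_mul_transpose_self {m n : ℕ} {M : Matrix (Fin m) (Fin n) ℝ}
    (hM : LinearIndependent ℝ (fun i => M i)) : (M * Mᵀ).PosDef := by
  rw [← conjTranspose_eq_transpose_of_trivial]
  exact PosDef.mul_conjTranspose_self M (vecMul_injective_iff.2 hM)

/-- Sherman–Morrison formula for a symmetric rank-one update of a positive definite matrix. -/
lemma inv_add_vecMulVec_self {n : ℕ} {S : Matrix (Fin n) (Fin n) ℝ} (hS : S.PosDef)
    (b : Fin n → ℝ) :
    (S + vecMulVec b b)⁻¹ =
      (1 - vecMulVec ((1 + b ⬝ᵥ (S⁻¹ *ᵥ b))⁻¹ • (S⁻¹ *ᵥ b)) b) * S⁻¹ := by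
  have hs : 0 ≤ b ⬝ᵥ (S⁻¹ *ᵥ b) := by
    simpa using hS.inv.posSemidef.dotProduct_mulVec_nonneg b
  have hSG : S * S⁻¹ = 1 := mul_nonsing_inv S ((isUnit_iff_isUnit_det S).1 hS.isUnit)
  set s := b ⬝ᵥ (S⁻¹ *ᵥ b) with hs_def
  have hs1 : (1 + s) ≠ 0 := by positivity
  have hSb : S *ᵥ (S⁻¹ *ᵥ b) = b := by rw [mulVec_mulVec, hSG, one_mulVec]
  apply inv_eq_right_inv
  have key : (S + vecMulVec b b) * (1 - vecMulVec ((1 + s)⁻¹ • (S⁻¹ *ᵥ b)) b) = S := by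
    rw [mul_sub, mul_one, add_mul, mul_vecMulVec, vecMulVec_mul_vecMulVec, mulVec_smul, hSb,
      dotProduct_smul, ← hs_def]
    ext i j
    simp [vecMulVec_apply]
    field_simp
    ring
  rw [← mul_assoc, key, hSG]

/-- the pseudoinverse of `[Aᵀ; bᵀ]` in the overparametrized regime
(Lemma 3 of the paper). -/
theorem stmt11 (n d : ℕ) (hnd : n ≤ d)
    (A : Matrix (Fin n) (Fin d) ℝ) (b : Fin n → ℝ)
    (hA : LinearIndependent ℝ (fun i => A i))
    (hAb : LinearIndependent ℝ (fun i => appendCol A b i))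
    (G : Matrix (Fin n) (Fin n) ℝ) (hG : G = (A * Aᵀ)⁻¹)
    (u : Fin n → ℝ) (hu : u = (1 + b ⬝ᵥ (G *ᵥ b))⁻¹ • (b ᵥ* G)) :
    pinvCols (appendRow Aᵀ b) =
      appendCol ((1 - vecMulVec b u)ᵀ * (pinvRows A)ᵀ) u := by
  have hS := posDef_mul_transpose_self hA
  have hGt : Gᵀ = G := by
    rw [hG, transpose_nonsing_inv, transpose_mul, transpose_transpose]
  have hs : 0 ≤ b ⬝ᵥ (G *ᵥ b) := by
    simpa [hG] using hS.inv.posSemidef.dotProduct_mulVec_nonneg b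
  have hbG : b ᵥ* G = G *ᵥ b := by rw [← mulVec_transpose, hGt]
  rw [hbG] at hu
  have hinv : (A * Aᵀ + vecMulVec b b)⁻¹ = (1 - vecMulVec u b) * G := by
    rw [inv_add_vecMulVec_self hS, ← hG, ← hu]
  have hGb : ((1 - vecMulVec u b) * G) *ᵥ b = u := by
    rw [← mulVec_mulVec, sub_mulVec, one_mulVec, vecMulVec_mulVec]
    ext i
    simp [hu]
    field_simp
    ring
  rw [pinvCols, appendRow_transpose, transpose_transpose, appendCol_mul_transpose_self, hinv,
    mul_appendCol, hGb, pinvRows, ← hG, transpose_mul, hGt, transpose_transpose,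
    transpose_sub, transpose_one, transpose_vecMulVec, Matrix.mul_assoc]

end
end
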